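/- Let K ⊂ ℝⁿ be a nonempty convex and compact set, let A be an n×n symmetric positive definite matrix, let y ∈ ℝⁿ and x ∈ K, and suppose that (y − z)ᵀ A (y − x) ≥ (2/3)‖y − x‖_A² for every z ∈ K. Then the point y⁺ = y − (2/3)(y − x) satisfies dist_A(y⁺, K)² ≤ e^{−4/9} · dist_A(y, K)². -/

import Mathlib

open Matrix

/-- The `A`-norm `‖x‖_A = √(xᵀ A x)`. -/
noncomputable def Anorm {n : ℕ} (A : Matrix (Fin n) (Fin n) ℝ) (x : Fin n → ℝ) : ℝ :=
  Real.sqrt (x ⬝ᵥ A.mulVec x)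

/-- The `A`-distance from a point `y` to the set `K`: `dist_A(y, K) = min_{z ∈ K} ‖y - z‖_A`. -/
noncomputable def distA {n : ℕ} (A : Matrix (Fin n) (Fin n) ℝ) (y : Fin n → ℝ)
    (K : Set (Fin n → ℝ)) : ℝ := sInf ((fun z => Anorm A (y - z)) '' K)

theorem Anorm_sq {n : ℕ} {A : Matrix (Fin n) (Fin n) ℝ} (hA : A.PosSemidef) (x : Fin n → ℝ) :
    Anorm A x ^ 2 = x ⬝ᵥ A.mulVec x :=
  Real.sq_sqrt (by simpa using hA.dotProduct_mulVec_nonneg x)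

theorem Anorm_nonneg {n : ℕ} (A : Matrix (Fin n) (Fin n) ℝ) (x : Fin n → ℝ) : 0 ≤ Anorm A x :=
  Real.sqrt_nonneg _

theorem continuous_Anorm {n : ℕ} (A : Matrix (Fin n) (Fin n) ℝ) : Continuous (Anorm A) := by
  unfold Anorm
  fun_prop

theorem Anorm_sub_smul_sq {n : ℕ} {A : Matrix (Fin n) (Fin n) ℝ} (hA : A.PosSemidef)
    (u w : Fin n → ℝ) (c : ℝ) :
    Anorm A (u - c • w) ^ 2 =
      Anorm A u ^ 2 - 2 * c * (u ⬝ᵥ A.mulVec w) + c ^ 2 * Anorm A w ^ 2 := by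
  have hsymm : w ⬝ᵥ A.mulVec u = u ⬝ᵥ A.mulVec w := by
    have hT : Aᵀ = A := by simpa [IsHermitian] using hA.isHermitian
    rw [dotProduct_mulVec, ← mulVec_transpose, hT, dotProduct_comm]
  simp only [Anorm_sq hA, mulVec_sub, mulVec_smul, sub_dotProduct, dotProduct_sub,
    smul_dotProduct, dotProduct_smul, smul_eq_mul, hsymm]
  ring

theorem distA_nonneg {n : ℕ} (A : Matrix (Fin n) (Fin n) ℝ) (y : Fin n → ℝ)
    (K : Set (Fin n → ℝ)) : 0 ≤ distA A y K :=
  Real.sInf_nonneg (by rintro _ ⟨z, -, rfl⟩; exact Anorm_nonneg _ _)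

theorem distA_le {n : ℕ} (A : Matrix (Fin n) (Fin n) ℝ) (y : Fin n → ℝ)
    {K : Set (Fin n → ℝ)} {z : Fin n → ℝ} (hz : z ∈ K) : distA A y K ≤ Anorm A (y - z) :=
  csInf_le ⟨0, by rintro _ ⟨z, -, rfl⟩; exact Anorm_nonneg _ _⟩ ⟨z, hz, rfl⟩

theorem IsCompact.exists_distA_eq {n : ℕ} {K : Set (Fin n → ℝ)} (hK : IsCompact K)
    (hne : K.Nonempty) (A : Matrix (Fin n) (Fin n) ℝ) (y : Fin n → ℝ) :
    ∃ p ∈ K, distA A y K = Anorm A (y - p) :=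
  hK.exists_sInf_image_eq hne
    ((continuous_Anorm A).comp (continuous_const.sub continuous_id)).continuousOn

/-- one pulling step contracts the squared `A`-distance to `K` by a factor
`e^{-4/9}`. -/
theorem pull_step_contracts_distance {n : ℕ}
    (K : Set (Fin n → ℝ)) (hKne : K.Nonempty) (hKconv : Convex ℝ K) (hKcomp : IsCompact K)
    (A : Matrix (Fin n) (Fin n) ℝ) (hA : A.PosDef)
    (y : Fin n → ℝ) (x : Fin n → ℝ) (hx : x ∈ K)
    (hsep : ∀ z ∈ K, (2 / 3) * Anorm A (y - x) ^ 2 ≤ (y - z) ⬝ᵥ A.mulVec (y - x)) :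
    distA A (y - (2 / 3 : ℝ) • (y - x)) K ^ 2 ≤ Real.exp (-(4 / 9)) * distA A y K ^ 2 := by
  obtain ⟨p, hp, hdist⟩ := hKcomp.exists_distA_eq hKne A y
  have hstep : distA A (y - (2 / 3 : ℝ) • (y - x)) K ^ 2 ≤
      Anorm A ((y - p) - (2 / 3 : ℝ) • (y - x)) ^ 2 := by
    rw [sub_right_comm y p]
    exact pow_le_pow_left₀ (distA_nonneg _ _ _) (distA_le _ _ hp) 2
  rw [Anorm_sub_smul_sq hA.posSemidef, ← hdist] at hstep
  have hle : distA A y K ^ 2 ≤ Anorm A (y - x) ^ 2 :=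
    pow_le_pow_left₀ (distA_nonneg _ _ _) (distA_le _ _ hx) 2
  have hexp : (5 / 9 : ℝ) ≤ Real.exp (-(4 / 9)) := by
    linarith [Real.add_one_le_exp (-(4 / 9) : ℝ)]
  calc distA A (y - (2 / 3 : ℝ) • (y - x)) K ^ 2 ≤ 5 / 9 * distA A y K ^ 2 := by
        linarith [hsep p hp]
    _ ≤ Real.exp (-(4 / 9)) * distA A y K ^ 2 := by gcongr
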